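/- Let φ : ℝ × ℝ → ℝ be smooth with φ_x nowhere zero, satisfying the KdV singularity manifold equation φ_t = φ_x {φ; x} at every point, where {φ; x} = (φ_xx/φ_x)_x − (1/2)(φ_xx/φ_x)². Then the function v := φ_xx / (2 φ_x) satisfies the mKdV equation v_t = v_xxx − 6 v² v_x at every point. -/

import Mathlib

/-- Partial derivative with respect to the first (space) variable. -/
noncomputable def px (f : ℝ × ℝ → ℝ) : ℝ × ℝ → ℝ :=
  fun p => deriv (fun x => f (x, p.2)) p.1

/-- Partial derivative with respect to the second (time) variable. -/
noncomputable def pt (f : ℝ × ℝ → ℝ) : ℝ × ℝ → ℝ :=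
  fun p => deriv (fun t => f (p.1, t)) p.2

/-- Schwarzian derivative of `f` with respect to the space variable:
`{f; x} = (f_xx / f_x)_x - (1/2) (f_xx / f_x)²`. -/
noncomputable def schwarz (f : ℝ × ℝ → ℝ) : ℝ × ℝ → ℝ :=
  fun p => px (fun q => px (px f) q / px f q) p - (1/2) * (px (px f) p / px f p) ^ 2


theorem hasDerivAt_px {f : ℝ × ℝ → ℝ} (hf : Differentiable ℝ f) (p : ℝ × ℝ) :
    HasDerivAt (fun x => f (x, p.2)) (px f p) p.1 :=
  ((hf _).comp p.1 (by fun_prop : DifferentiableAt ℝ (fun x : ℝ => (x, p.2)) p.1)).hasDerivAt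

theorem hasDerivAt_pt {f : ℝ × ℝ → ℝ} (hf : Differentiable ℝ f) (p : ℝ × ℝ) :
    HasDerivAt (fun t => f (p.1, t)) (pt f p) p.2 :=
  ((hf _).comp p.2 (by fun_prop : DifferentiableAt ℝ (fun t : ℝ => (p.1, t)) p.2)).hasDerivAt

theorem px_eq_fderiv {f : ℝ × ℝ → ℝ} (hf : Differentiable ℝ f) :
    px f = fun p => fderiv ℝ f p (1, 0) := by
  funext p
  exact ((hf p).hasFDerivAt.comp_hasDerivAt p.1
    ((hasDerivAt_id p.1).prodMk (hasDerivAt_const p.1 p.2))).deriv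

theorem pt_eq_fderiv {f : ℝ × ℝ → ℝ} (hf : Differentiable ℝ f) :
    pt f = fun p => fderiv ℝ f p (0, 1) := by
  funext p
  exact ((hf p).hasFDerivAt.comp_hasDerivAt p.2
    ((hasDerivAt_const p.2 p.1).prodMk (hasDerivAt_id p.2))).deriv

theorem differentiable_of_smooth {f : ℝ × ℝ → ℝ} (hf : ContDiff ℝ (⊤ : ℕ∞) f) :
    Differentiable ℝ f :=
  hf.differentiable (by simp)

theorem contDiff_px {f : ℝ × ℝ → ℝ} (hf : ContDiff ℝ (⊤ : ℕ∞) f) :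
    ContDiff ℝ (⊤ : ℕ∞) (px f) := by
  rw [px_eq_fderiv (differentiable_of_smooth hf)]
  exact (hf.fderiv_right (m := (⊤ : ℕ∞)) (by simp)).clm_apply contDiff_const

theorem contDiff_pt {f : ℝ × ℝ → ℝ} (hf : ContDiff ℝ (⊤ : ℕ∞) f) :
    ContDiff ℝ (⊤ : ℕ∞) (pt f) := by
  rw [pt_eq_fderiv (differentiable_of_smooth hf)]
  exact (hf.fderiv_right (m := (⊤ : ℕ∞)) (by simp)).clm_apply contDiff_const

/-- The space and time derivatives of a smooth function commute. -/
theorem pt_px_comm {f : ℝ × ℝ → ℝ} (hf : ContDiff ℝ (⊤ : ℕ∞) f) (p : ℝ × ℝ) :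
    pt (px f) p = px (pt f) p := by
  have hd : Differentiable ℝ (fderiv ℝ f) :=
    (hf.fderiv_right (m := (⊤ : ℕ∞)) (by simp)).differentiable (by simp)
  have hsymm : IsSymmSndFDerivAt ℝ f p :=
    hf.contDiffAt.isSymmSndFDerivAt (by simpa using WithTop.coe_le_coe.2 (le_top : (2 : ℕ∞) ≤ ⊤))
  rw [pt_eq_fderiv (differentiable_of_smooth (contDiff_px hf)),
    px_eq_fderiv (differentiable_of_smooth (contDiff_pt hf)),
    px_eq_fderiv (differentiable_of_smooth hf), pt_eq_fderiv (differentiable_of_smooth hf)]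
  simp only [fderiv_clm_apply (hd p) (differentiableAt_const _)]
  simpa using hsymm (0, 1) (1, 0)

theorem px_mul {f g : ℝ × ℝ → ℝ} (hf : Differentiable ℝ f) (hg : Differentiable ℝ g)
    (p : ℝ × ℝ) : px (fun q => f q * g q) p = px f p * g p + f p * px g p :=
  ((hasDerivAt_px hf p).mul (hasDerivAt_px hg p)).deriv

theorem pt_mul {f g : ℝ × ℝ → ℝ} (hf : Differentiable ℝ f) (hg : Differentiable ℝ g)
    (p : ℝ × ℝ) : pt (fun q => f q * g q) p = pt f p * g p + f p * pt g p :=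
  ((hasDerivAt_pt hf p).mul (hasDerivAt_pt hg p)).deriv

theorem px_const_mul {f : ℝ × ℝ → ℝ} (hf : Differentiable ℝ f) (c : ℝ) (p : ℝ × ℝ) :
    px (fun q => c * f q) p = c * px f p :=
  ((hasDerivAt_px hf p).const_mul c).deriv

theorem pt_const_mul {f : ℝ × ℝ → ℝ} (hf : Differentiable ℝ f) (c : ℝ) (p : ℝ × ℝ) :
    pt (fun q => c * f q) p = c * pt f p :=
  ((hasDerivAt_pt hf p).const_mul c).deriv

theorem px_sub {f g : ℝ × ℝ → ℝ} (hf : Differentiable ℝ f) (hg : Differentiable ℝ g)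
    (p : ℝ × ℝ) : px (fun q => f q - g q) p = px f p - px g p :=
  ((hasDerivAt_px hf p).sub (hasDerivAt_px hg p)).deriv

theorem px_pow {f : ℝ × ℝ → ℝ} (hf : Differentiable ℝ f) (n : ℕ) (p : ℝ × ℝ) :
    px (fun q => f q ^ n) p = n * f p ^ (n - 1) * px f p :=
  ((hasDerivAt_px hf p).pow n).deriv

/-- If `φ` solves the KdV singularity manifold equation `φ_t = φ_x {φ; x}` with `φ_x`
nowhere zero, then `v := φ_xx / (2 φ_x)` solves the mKdV equation
`v_t = v_xxx - 6 v² v_x`. -/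
theorem kdvSing_to_mkdv
    (φ : ℝ × ℝ → ℝ) (hφ : ContDiff ℝ (⊤ : ℕ∞) φ) (hφx : ∀ p, px φ p ≠ 0)
    (hsing : ∀ p, pt φ p = px φ p * schwarz φ p) :
    ∀ p, pt (fun q => px (px φ) q / (2 * px φ q)) p =
      px (px (px (fun q => px (px φ) q / (2 * px φ q)))) p -
        6 * (px (px φ) p / (2 * px φ p)) ^ 2 *
          px (fun q => px (px φ) q / (2 * px φ q)) p := by
  intro p
  have hu := contDiff_px hφ
  have hux (q : ℝ × ℝ) : px (px φ) q = 2 * (px φ q * (px (px φ) q / (2 * px φ q))) := by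
    have := hφx q
    field_simp
  have hquot (q : ℝ × ℝ) : px (px φ) q / px φ q = 2 * (px (px φ) q / (2 * px φ q)) := by
    have := hφx q
    field_simp
  have hv : ContDiff ℝ (⊤ : ℕ∞) (fun q => px (px φ) q / (2 * px φ q)) :=
    (contDiff_px hu).div (contDiff_const.mul hu) fun q => mul_ne_zero two_ne_zero (hφx q)
  simp only [schwarz, hquot] at hsing
  obtain ⟨v, hvdef⟩ : ∃ v, v = fun q => px (px φ) q / (2 * px φ q) := ⟨_, rfl⟩
  have hvq (q : ℝ × ℝ) : px (px φ) q / (2 * px φ q) = v q := (congrFun hvdef q).symm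
  simp only [hvq] at hux hv hsing ⊢
  have du := differentiable_of_smooth hu
  have dv := differentiable_of_smooth hv
  have dvx := differentiable_of_smooth (contDiff_px hv)
  have dvxx := differentiable_of_smooth (contDiff_px (contDiff_px hv))
  have hφt : pt φ = fun q => px φ q * (2 * px v q - 2 * v q ^ 2) := by
    funext q
    rw [hsing, px_const_mul dv]
    ring
  have hut : pt (px φ) = fun q => px φ q * (2 * px (px v) q - 4 * v q ^ 3) := by
    funext q
    rw [pt_px_comm hφ, hφt, px_mul du (by fun_prop), px_sub (by fun_prop) (by fun_prop),
      px_const_mul dvx, px_const_mul (by fun_prop), px_pow dv, hux]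
    push_cast
    ring
  have h := pt_px_comm hu p
  rw [hut, px_mul du (by fun_prop), px_sub (by fun_prop) (by fun_prop), px_const_mul dvxx,
    px_const_mul (by fun_prop), px_pow dv, funext hux, pt_const_mul (by fun_prop),
    pt_mul du dv, hut] at h
  apply mul_left_cancel₀ (hφx p)
  push_cast at h
  linear_combination h / 2
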